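/- Let (g, Φ = (D, θ), ⟨·,·⟩) be an extrinsic symmetric triple with n = dim g₋⁻ ≥ 1, and suppose that D = ad ξ for some ξ ∈ g with θ(ξ) = −ξ. Then for every η ∈ g₋⁺ one has n·⟨h, η⟩ = (1/2)·B_g(η, ξ), where B_g(x,y) = tr(ad x ∘ ad y) is the Killing form of g and h is the mean curvature vector. -/

import Mathlib

/-- The span of all brackets `⁅u, v⁆` with `u ∈ U`, `v ∈ V`. -/
def bracketSpan {L : Type} [LieRing L] [LieAlgebra ℝ L]
    (U V : Submodule ℝ L) : Submodule ℝ L :=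
  Submodule.span ℝ {z | ∃ u ∈ U, ∃ v ∈ V, z = ⁅u, v⁆}

/-- An extrinsic symmetric triple `(g, (D, θ), ⟨·,·⟩)`: a metric Lie algebra with an
invariant nondegenerate symmetric bilinear form, an isometric involutive automorphism `θ`,
and an antisymmetric derivation `D` with `D³ = -D`, `Dθ = -θD` and `g₊⁺ = [g₊⁻, g₊⁻]`. -/
structure ExtSymTriple (L : Type) [LieRing L] [LieAlgebra ℝ L] [Module.Finite ℝ L] where
  B : LinearMap.BilinForm ℝ L
  Bsymm : ∀ x y, B x y = B y x
  Binv : ∀ x y z, B ⁅x, y⁆ z = B x ⁅y, z⁆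
  Bnondeg : B.Nondegenerate
  theta : L →ₗ[ℝ] L
  thetaLie : ∀ x y, theta ⁅x, y⁆ = ⁅theta x, theta y⁆
  thetaInvol : ∀ x, theta (theta x) = x
  thetaIso : ∀ x y, B (theta x) (theta y) = B x y
  D : L →ₗ[ℝ] L
  Dder : ∀ x y, D ⁅x, y⁆ = ⁅D x, y⁆ + ⁅x, D y⁆
  Danti : ∀ x y, B (D x) y = - B x (D y)
  D3 : ∀ x, D (D (D x)) = - D x
  Dtheta : ∀ x, D (theta x) = - theta (D x)
  cartan : (LinearMap.ker (theta - LinearMap.id) ⊓ LinearMap.ker D) =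
    bracketSpan
      (LinearMap.ker (theta - LinearMap.id) ⊓ LinearMap.ker (D ∘ₗ D + LinearMap.id))
      (LinearMap.ker (theta - LinearMap.id) ⊓ LinearMap.ker (D ∘ₗ D + LinearMap.id))

namespace ExtSymTriple

variable {L : Type} [LieRing L] [LieAlgebra ℝ L] [Module.Finite ℝ L] (T : ExtSymTriple L)

/-- `g₊⁺ = g₊ ∩ g⁺`. -/
def gPlusUp : Submodule ℝ L :=
  LinearMap.ker (T.theta - LinearMap.id) ⊓ LinearMap.ker T.D

/-- `g₊⁻ = g₊ ∩ g⁻`. -/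
def gPlusDown : Submodule ℝ L :=
  LinearMap.ker (T.theta - LinearMap.id) ⊓ LinearMap.ker (T.D ∘ₗ T.D + LinearMap.id)

/-- `g₋⁺ = g₋ ∩ g⁺`. -/
def gMinusUp : Submodule ℝ L :=
  LinearMap.ker (T.theta + LinearMap.id) ⊓ LinearMap.ker T.D

/-- `g₋⁻ = g₋ ∩ g⁻`. -/
def gMinusDown : Submodule ℝ L :=
  LinearMap.ker (T.theta + LinearMap.id) ⊓ LinearMap.ker (T.D ∘ₗ T.D + LinearMap.id)

/-- Indecomposability: `g` is not the direct sum of two nonzero ideals that are orthogonal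
to each other and invariant under `θ` and `D`. -/
def Indecomposable : Prop :=
  ¬ ∃ I J : LieIdeal ℝ L, I ≠ ⊥ ∧ J ≠ ⊥ ∧
    (I : Submodule ℝ L) ⊓ (J : Submodule ℝ L) = ⊥ ∧
    (I : Submodule ℝ L) ⊔ (J : Submodule ℝ L) = ⊤ ∧
    (∀ x ∈ I, ∀ y ∈ J, T.B x y = 0) ∧
    (∀ x ∈ I, T.theta x ∈ I) ∧ (∀ x ∈ I, T.D x ∈ I) ∧
    (∀ x ∈ J, T.theta x ∈ J) ∧ (∀ x ∈ J, T.D x ∈ J)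

end ExtSymTriple

namespace ExtSymTriple

variable {L : Type} [LieRing L] [LieAlgebra ℝ L] [Module.Finite ℝ L] (T : ExtSymTriple L)

/-- The projection `-D² (1 - θ) / 2` onto `g₋⁻`. -/
noncomputable def projMinusDown : L →ₗ[ℝ] L :=
  -(1 / 2 : ℝ) • (T.D * T.D * (1 - T.theta))

lemma projMinusDown_apply (x : L) :
    T.projMinusDown x = -(1 / 2 : ℝ) • (T.D (T.D x) - T.theta (T.D (T.D x))) := by
  simp only [projMinusDown, LinearMap.smul_apply, Module.End.mul_apply, LinearMap.sub_apply,
    Module.End.one_apply, map_sub, T.Dtheta, map_neg, neg_neg]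

lemma mem_gMinusDown {x : L} : x ∈ T.gMinusDown ↔ T.theta x = -x ∧ T.D (T.D x) = -x := by
  simp [gMinusDown, add_eq_zero_iff_eq_neg]

lemma projMinusDown_mem (x : L) : T.projMinusDown x ∈ T.gMinusDown := by
  rw [mem_gMinusDown, projMinusDown_apply]
  constructor
  · simp only [map_smul, map_sub, T.thetaInvol]
    module
  · simp only [map_smul, map_sub, T.Dtheta, map_neg, T.D3]
    module

lemma B_projMinusDown {e : L} (he : e ∈ T.gMinusDown) (x : L) :
    T.B e (T.projMinusDown x) = T.B e x := by
  obtain ⟨h₁, h₂⟩ := T.mem_gMinusDown.1 he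
  have hθ (y : L) : T.B e (T.theta y) = -T.B e y := by
    rw [← T.thetaIso, h₁, T.thetaInvol]
    simp
  have hD : T.B e (T.D (T.D x)) = -T.B e x := by
    have h₃ := T.Danti e (T.D x)
    have h₄ := T.Danti (T.D e) x
    rw [h₂, map_neg, LinearMap.neg_apply] at h₄
    linarith
  simp only [projMinusDown_apply, map_smul, map_sub, hθ, hD, smul_eq_mul]
  ring

/-- An endomorphism `A` with `A D² = -A` that commutes with `D` has half of its trace
on `g₋⁻`. -/
lemma trace_mul_projMinusDown {A : L →ₗ[ℝ] L} (hc : Commute T.D A)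
    (hA : A * (T.D * T.D) = -A) :
    LinearMap.trace ℝ L (A * T.projMinusDown) = (1 / 2) * LinearMap.trace ℝ L A := by
  have hθD : T.D * T.theta = -(T.theta * T.D) := LinearMap.ext T.Dtheta
  have hzero : LinearMap.trace ℝ L (A * T.theta) = 0 := by
    have h₁ : A * T.theta = A * T.D * (T.theta * T.D) := by
      calc A * T.theta = -(A * (T.D * T.D)) * T.theta := by rw [hA, neg_neg]
        _ = -(A * T.D * (T.D * T.theta)) := by noncomm_ring
        _ = A * T.D * (T.theta * T.D) := by rw [hθD]; noncomm_ring
    have h₂ : LinearMap.trace ℝ L (A * T.D * (T.theta * T.D)) =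
        LinearMap.trace ℝ L (-(A * T.theta)) := by
      rw [← mul_assoc, LinearMap.trace_mul_comm, ← mul_assoc, ← mul_assoc, hc.eq,
        mul_assoc A, hA, neg_mul]
    rw [← h₁, map_neg] at h₂
    linarith
  have h : A * T.projMinusDown = (1 / 2 : ℝ) • (A - A * T.theta) := by
    rw [projMinusDown, mul_smul_comm, ← mul_assoc, hA, neg_mul, mul_sub, mul_one, smul_neg,
      neg_smul, neg_neg]
  rw [h, map_smul, map_sub, hzero, sub_zero, smul_eq_mul]

end ExtSymTriple

/-- Expansion of a vector in the span of a pseudo-orthonormal family. -/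
lemma eq_sum_of_mem_span_orthonormal {V ι : Type*} [AddCommGroup V] [Module ℝ V] [Fintype ι]
    (B : LinearMap.BilinForm ℝ V) {e : ι → V} {κ : ι → ℝ}
    (horth : ∀ i j, i ≠ j → B (e i) (e j) = 0) (hκ : ∀ j, B (e j) (e j) = κ j)
    (hκ1 : ∀ j, κ j = 1 ∨ κ j = -1) {x : V} (hx : x ∈ Submodule.span ℝ (Set.range e)) :
    x = ∑ j, (κ j * B (e j) x) • e j := by
  induction hx using Submodule.span_induction with
  | mem x hx =>
    obtain ⟨i, rfl⟩ := hx
    rw [Finset.sum_eq_single i (fun j _ hj => by simp [horth j i hj]) (by simp), hκ]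
    rcases hκ1 i with h | h <;> simp [h]
  | zero => simp
  | add x y _ _ hx hy =>
    simp only [map_add, mul_add, add_smul, Finset.sum_add_distrib]
    rw [← hx, ← hy]
  | smul a x _ hx =>
    simp only [map_smul, smul_eq_mul, mul_left_comm _ a, mul_smul a, ← Finset.smul_sum]
    rw [← hx]

/-- For an extrinsic symmetric triple of Ferus type (`D = ad ξ`, `θ ξ = -ξ`), the mean
curvature vector `h` satisfies `n ⟨h, η⟩ = (1/2) B_g(η, ξ)` for every `η ∈ g₋⁺`. -/
theorem meanCurvature_pairing
    {L : Type} [LieRing L] [LieAlgebra ℝ L] [Module.Finite ℝ L]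
    (T : ExtSymTriple L)
    (n : ℕ) (hn : 1 ≤ n) (hdim : n = Module.finrank ℝ T.gMinusDown)
    (e : Fin n → L) (hmem : ∀ j, e j ∈ T.gMinusDown)
    (hspan : ∀ x ∈ T.gMinusDown, x ∈ Submodule.span ℝ (Set.range e))
    (horth : ∀ i j, i ≠ j → T.B (e i) (e j) = 0)
    (κ : Fin n → ℝ) (hκ : ∀ j, T.B (e j) (e j) = κ j) (hκ1 : ∀ j, κ j = 1 ∨ κ j = -1)
    (h : L) (hh : h = (n : ℝ)⁻¹ • ∑ j, κ j • ⁅T.D (e j), e j⁆)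
    (ξ : L) (hξ : ∀ x, T.D x = ⁅ξ, x⁆) (hθξ : T.theta ξ = -ξ) :
    ∀ η ∈ T.gMinusUp, (n : ℝ) * T.B h η = (1 / 2) * killingForm ℝ L η ξ := by
  intro η hη
  obtain ⟨-, hDη⟩ := hη
  replace hDη : T.D η = 0 := hDη
  set A : L →ₗ[ℝ] L := LieAlgebra.ad ℝ L η * T.D with hAdef
  have hA_apply (x : L) : A x = ⁅η, T.D x⁆ := rfl
  have hkill : killingForm ℝ L η ξ = LinearMap.trace ℝ L A := by
    have hD : T.D = LieAlgebra.ad ℝ L ξ := LinearMap.ext hξ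
    rw [hAdef, hD]
    rfl
  have hc : Commute T.D A := LinearMap.ext fun x => by
    simp [hA_apply, T.Dder, hDη]
  have hA : A * (T.D * T.D) = -A := LinearMap.ext fun x => by
    simp [hA_apply, T.D3]
  have hproj : A * T.projMinusDown = ∑ j, κ j • (T.B (e j)).smulRight (A (e j)) := by
    ext x
    rw [Module.End.mul_apply, eq_sum_of_mem_span_orthonormal T.B horth hκ hκ1
      (hspan _ (T.projMinusDown_mem x))]
    simp [T.B_projMinusDown (hmem _), mul_smul]
  have hterm (j : Fin n) : T.B ⁅T.D (e j), e j⁆ η = T.B (e j) (A (e j)) := by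
    have h₁ : T.D ⁅e j, η⁆ = -A (e j) := by
      rw [hA_apply, T.Dder, hDη, lie_zero, add_zero, lie_skew]
    rw [T.Binv, T.Danti, h₁, map_neg, neg_neg]
  have hn0 : (n : ℝ) ≠ 0 := by positivity
  rw [hkill, ← T.trace_mul_projMinusDown hc hA, hproj, hh]
  simp [hterm, hn0]
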